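/- Let φ, φ̃ ∈ X, h = φ̃ − φ, and s > 0. Then λ ↦ a_{φ+λh}^{-1}(s) is differentiable on [0,1] with derivative ∂_λ a_{φ+λh}^{-1}(s) = [∫(a_{φ+λh}^{-1}(s) − φ − λh)₊^{1/2} h dx] / [∫(a_{φ+λh}^{-1}(s) − φ − λh)₊^{1/2} dx]. -/

import Mathlib

open MeasureTheory Real Filter Set ENNReal

noncomputable section

abbrev R3 := EuclideanSpace ℝ (Fin 3)

def mX (φ : R3 → ℝ) : ℝ := ⨅ x : R3, (1 + ‖x‖) * |φ x|

def memX (φ : R3 → ℝ) : Prop :=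
  Continuous φ ∧ (∀ x, φ x ≤ 0) ∧ Tendsto φ (cocompact R3) (nhds 0) ∧
    Integrable (fun x => ‖fderiv ℝ φ x‖ ^ 2) ∧ 0 < mX φ

def aphi (φ : R3 → ℝ) (e : ℝ) : ℝ :=
  (8 * π * Real.sqrt 2 / 3) * ∫ x : R3, (max (e - φ x) 0) ^ ((3 : ℝ) / 2)

/-- Inverse of the Jacobian `a_ψ` (as the generalized inverse). -/
def aInv (ψ : R3 → ℝ) (s : ℝ) : ℝ := sInf {e : ℝ | s ≤ aphi ψ e}

/-- The positive part to the power `3 / 2` is differentiable everywhere. -/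
lemma hasDerivAt_max_zero_rpow (t : ℝ) :
    HasDerivAt (fun t : ℝ => (max t 0) ^ ((3 : ℝ) / 2))
      (3 / 2 * (max t 0) ^ ((1 : ℝ) / 2)) t := by
  have key : ∀ p : ℝ, p ≠ 0 → cos (p * π) = 0 → ∀ t : ℝ, (max t 0) ^ p = t ^ p := by
    intro p hp hc t
    rcases le_or_gt 0 t with ht | ht
    · rw [max_eq_left ht]
    · rw [max_eq_right ht.le, Real.zero_rpow hp, Real.rpow_def_of_neg ht, hc, mul_zero]
  have h32 := key (3 / 2) (by norm_num) (by
    rw [show (3 : ℝ) / 2 * π = π / 2 + π by ring, Real.cos_add_pi, Real.cos_pi_div_two, neg_zero])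
  have h12 := key (1 / 2) (by norm_num) (by
    rw [show (1 : ℝ) / 2 * π = π / 2 by ring, Real.cos_pi_div_two])
  simp only [h32, h12]
  have := Real.hasDerivAt_rpow_const (x := t) (p := 3 / 2) (Or.inr (by norm_num))
  norm_num at this ⊢
  exact this

lemma exists_abs_le_of_tendsto_cocompact {ψ : R3 → ℝ} (hc : Continuous ψ)
    (h0 : Tendsto ψ (cocompact R3) (nhds 0)) : ∃ M, ∀ x, |ψ x| ≤ M := by
  let f : ZeroAtInftyContinuousMap R3 ℝ := ⟨⟨ψ, hc⟩, h0⟩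
  refine ⟨‖f.toBCF‖, fun x => ?_⟩
  exact f.toBCF.norm_coe_le_norm x

section Profile

variable {ψ : R3 → ℝ} {e p : ℝ}

lemma continuous_max_sub_rpow (hc : Continuous ψ) (hp : 0 < p) :
    Continuous (fun x => (max (e - ψ x) 0) ^ p) :=
  ((continuous_const.sub hc).max continuous_const).rpow_const fun _ => Or.inr hp.le

lemma hasCompactSupport_max_sub_rpow (h0 : Tendsto ψ (cocompact R3) (nhds 0)) (he : e < 0)
    (hp : 0 < p) : HasCompactSupport (fun x => (max (e - ψ x) 0) ^ p) := by
  obtain ⟨K, hK, hKs⟩ := mem_cocompact.1 (h0.eventually (lt_mem_nhds he))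
  refine HasCompactSupport.intro hK fun x hx => ?_
  have hx' : e < ψ x := hKs hx
  rw [max_eq_right (by linarith), Real.zero_rpow hp.ne']

lemma integrable_max_sub_rpow (hc : Continuous ψ) (h0 : Tendsto ψ (cocompact R3) (nhds 0))
    (he : e < 0) (hp : 0 < p) : Integrable (fun x => (max (e - ψ x) 0) ^ p) :=
  (continuous_max_sub_rpow hc hp).integrable_of_hasCompactSupport
    (hasCompactSupport_max_sub_rpow h0 he hp)

lemma aphi_const_pos : 0 < 8 * π * Real.sqrt 2 / 3 := by positivity

lemma aphi_mono (hc : Continuous ψ) (h0 : Tendsto ψ (cocompact R3) (nhds 0)) {e' : ℝ}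
    (hee : e ≤ e') (he : e' < 0) : aphi ψ e ≤ aphi ψ e' := by
  refine mul_le_mul_of_nonneg_left ?_ aphi_const_pos.le
  refine integral_mono (integrable_max_sub_rpow hc h0 (hee.trans_lt he) (by norm_num))
    (integrable_max_sub_rpow hc h0 he (by norm_num)) fun x => ?_
  exact Real.rpow_le_rpow (le_max_right _ _) (max_le_max (by linarith) le_rfl) (by norm_num)

lemma aphi_eq_zero_of_forall_le (h : ∀ x, e ≤ ψ x) : aphi ψ e = 0 := by
  have : ∀ x, (max (e - ψ x) 0) ^ ((3 : ℝ) / 2) = 0 := fun x => by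
    rw [max_eq_right (by linarith [h x]), Real.zero_rpow (by norm_num)]
  simp [aphi, this]

lemma bddBelow_aphi_superlevel (hc : Continuous ψ) (h0 : Tendsto ψ (cocompact R3) (nhds 0))
    {s : ℝ} (hs : 0 < s) : BddBelow {e : ℝ | s ≤ aphi ψ e} := by
  obtain ⟨M, hM⟩ := exists_abs_le_of_tendsto_cocompact hc h0
  refine ⟨-M, fun e he => ?_⟩
  by_contra! hlt
  have := aphi_eq_zero_of_forall_le (ψ := ψ) (e := e) fun x =>
    hlt.le.trans (neg_le_of_abs_le (hM x))
  rw [mem_ofPred_eq, this] at he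
  linarith

lemma aInv_le (hc : Continuous ψ) (h0 : Tendsto ψ (cocompact R3) (nhds 0))
    {s : ℝ} (hs : 0 < s) (h : s ≤ aphi ψ e) : aInv ψ s ≤ e :=
  csInf_le (bddBelow_aphi_superlevel hc h0 hs) h

lemma le_aInv (hc : Continuous ψ) (h0 : Tendsto ψ (cocompact R3) (nhds 0))
    {s : ℝ} (he : e < 0) (h : aphi ψ e < s) : e ≤ aInv ψ s := by
  rcases Set.eq_empty_or_nonempty {e : ℝ | s ≤ aphi ψ e} with hemp | hne
  · rw [aInv, hemp, Real.sInf_empty]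
    exact he.le
  · refine le_csInf hne fun b hb => ?_
    by_contra! hlt
    have := aphi_mono hc h0 hlt.le he
    rw [mem_ofPred_eq] at hb
    linarith

end Profile

lemma tendsto_add_mul_cocompact {φ h : R3 → ℝ} (hφ0 : Tendsto φ (cocompact R3) (nhds 0))
    (hh0 : Tendsto h (cocompact R3) (nhds 0)) (l : ℝ) :
    Tendsto (fun x => φ x + l * h x) (cocompact R3) (nhds 0) := by
  simpa using hφ0.add (hh0.const_mul l)

/-- Derivative of the Jacobian when the potential and the energy both vary affinely. -/
lemma hasDerivAt_aphi_affine {φ h : R3 → ℝ} (hφ : Continuous φ) (hh : Continuous h)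
    (hφ0 : Tendsto φ (cocompact R3) (nhds 0)) (hh0 : Tendsto h (cocompact R3) (nhds 0))
    (lam c : ℝ) {e : ℝ} (he : e < 0) :
    HasDerivAt (fun l => aphi (fun x => φ x + l * h x) (e + c * (l - lam)))
      ((8 * π * Real.sqrt 2 / 3) *
        ∫ x, 3 / 2 * (max (e - (φ x + lam * h x)) 0) ^ ((1 : ℝ) / 2) * (c - h x)) lam := by
  refine HasDerivAt.const_mul _ ?_
  have he2 : 0 < -e / 2 := by linarith
  obtain ⟨δ, hδ, hδ1, hδc⟩ : ∃ δ > 0, δ ≤ 1 ∧ |c| * δ ≤ -e / 2 := by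
    have hc1 : 0 < |c| + 1 := by positivity
    have hpos : 0 < min 1 (-e / 2 / (|c| + 1)) := lt_min one_pos (div_pos he2 hc1)
    refine ⟨_, hpos, min_le_left _ _, ?_⟩
    have hle := (le_div_iff₀ hc1).1 (min_le_right 1 (-e / 2 / (|c| + 1)))
    linarith
  have hsmall : Tendsto (fun x => |φ x| + (|lam| + 1) * |h x|) (cocompact R3) (nhds 0) := by
    simpa using hφ0.abs.add (hh0.abs.const_mul (|lam| + 1))
  obtain ⟨K, hK, hKs⟩ := mem_cocompact.1 (hsmall.eventually (gt_mem_nhds he2))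
  have hbd : ∀ l ∈ Metric.ball lam δ, |l| ≤ |lam| + 1 ∧ |c * (l - lam)| ≤ -e / 2 := by
    intro l hl
    rw [Metric.mem_ball, Real.dist_eq] at hl
    constructor
    · have := abs_sub_abs_le_abs_sub l lam
      linarith
    · rw [abs_mul]
      exact (mul_le_mul_of_nonneg_left hl.le (abs_nonneg c)).trans hδc
  have hbd2 : ∀ l ∈ Metric.ball lam δ, ∀ x, |φ x + l * h x| ≤ |φ x| + (|lam| + 1) * |h x| := by
    intro l hl x
    refine (abs_add_le _ _).trans ?_
    rw [abs_mul]
    gcongr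
    exact (hbd l hl).1
  have hcont : ∀ l, Continuous (fun x => φ x + l * h x) := fun l => hφ.add (hh.const_smul l)
  have hder := hasDerivAt_integral_of_dominated_loc_of_deriv_le
    (μ := (volume : Measure R3)) (s := Metric.ball lam δ) (x₀ := lam)
    (F := fun l x => (max (e + c * (l - lam) - (φ x + l * h x)) 0) ^ ((3 : ℝ) / 2))
    (F' := fun l x => 3 / 2 * (max (e + c * (l - lam) - (φ x + l * h x)) 0) ^ ((1 : ℝ) / 2)
      * (c - h x))
    (bound := K.indicator fun x =>
      3 / 2 * (|φ x| + (|lam| + 1) * |h x|) ^ ((1 : ℝ) / 2) * (|c| + |h x|))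
    (Metric.ball_mem_nhds _ hδ)
    (Eventually.of_forall fun l =>
      (continuous_max_sub_rpow (hcont l) (by norm_num)).aestronglyMeasurable)
    (by
      refine integrable_max_sub_rpow (hcont lam) (tendsto_add_mul_cocompact hφ0 hh0 lam) ?_
        (by norm_num)
      simpa using he)
    ((((continuous_max_sub_rpow (hcont lam) (by norm_num)).const_smul (3 / 2 : ℝ)).mul
      (continuous_const.sub hh)).aestronglyMeasurable)
    (Eventually.of_forall fun x l hl => by
      obtain ⟨-, h2⟩ := hbd l hl
      have h3 := hbd2 l hl x
      have h2' := (abs_le.1 h2).2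
      have h3' := (abs_le.1 h3).1
      by_cases hx : x ∈ K
      · rw [indicator_of_mem hx, norm_mul, norm_mul, Real.norm_eq_abs, Real.norm_eq_abs,
          Real.norm_eq_abs, abs_of_nonneg (Real.rpow_nonneg (le_max_right _ _) _),
          abs_of_nonneg (by norm_num : (0 : ℝ) ≤ 3 / 2)]
        gcongr
        · exact max_le (by linarith) (by positivity)
        · exact norm_sub_le c (h x)
      · have hx' : |φ x| + (|lam| + 1) * |h x| < -e / 2 := hKs hx
        rw [indicator_of_notMem hx, max_eq_right (by linarith),
          Real.zero_rpow (by norm_num)]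
        simp)
    (by
      rw [integrable_indicator_iff hK.measurableSet]
      refine Continuous.continuousOn ?_ |>.integrableOn_compact hK
      refine Continuous.mul (Continuous.mul continuous_const ?_) (by fun_prop)
      exact Continuous.rpow_const (by fun_prop) fun _ => Or.inr (by norm_num))
    (Eventually.of_forall fun x l _ => by
      have hin : HasDerivAt (fun l : ℝ => e + c * (l - lam) - (φ x + l * h x)) (c - h x) l := by
        have h1 := (((hasDerivAt_id l).sub_const lam).const_mul c).const_add e
        have h2 := ((hasDerivAt_id l).mul_const (h x)).const_add (φ x)
        simpa [Pi.sub_def] using h1.sub h2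
      exact (hasDerivAt_max_zero_rpow _).comp l hin)
  simpa using hder.2

lemma continuousAt_aphi {ψ : R3 → ℝ} (hc : Continuous ψ)
    (h0 : Tendsto ψ (cocompact R3) (nhds 0)) {e : ℝ} (he : e < 0) :
    ContinuousAt (aphi ψ) e := by
  have := (hasDerivAt_aphi_affine (h := fun _ => 0) hc continuous_const h0 tendsto_const_nhds
    e 1 he).continuousAt
  simpa using this

lemma exists_le_aphi {ψ : R3 → ℝ} (hc : Continuous ψ)
    (h0 : Tendsto ψ (cocompact R3) (nhds 0)) {m : ℝ} (hm : 0 < m)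
    (hψ : ∀ x, m / (1 + ‖x‖) ≤ -ψ x) (s : ℝ) : ∃ e < 0, s ≤ aphi ψ e := by
  set v : ℝ := (volume : Measure R3).real (Metric.ball 0 1) with hv
  have hvpos : 0 < v := by
    refine ENNReal.toReal_pos (Metric.measure_ball_pos _ _ one_pos).ne' measure_ball_lt_top.ne
  set k : ℝ := (8 * π * Real.sqrt 2 / 3) * (v * (m / 4) ^ ((3 : ℝ) / 2)) with hk
  have hkpos : 0 < k := mul_pos aphi_const_pos (by positivity)
  obtain ⟨R, hRs, hR1⟩ := (((tendsto_rpow_atTop (y := 3 / 2) (by norm_num)).const_mul_atTop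
    hkpos).eventually_ge_atTop s |>.and (eventually_ge_atTop (1 : ℝ))).exists
  have hR0 : 0 < R := by linarith
  have he : -(m / (4 * R)) < 0 := by
    have : 0 < m / (4 * R) := by positivity
    linarith
  refine ⟨-(m / (4 * R)), he, hRs.trans ?_⟩
  rw [aphi, hk, mul_assoc]
  refine mul_le_mul_of_nonneg_left ?_ aphi_const_pos.le
  have hball : (volume : Measure R3).real (Metric.ball 0 R) = R ^ 3 * v := by
    rw [hv, measureReal_def, Measure.addHaar_ball_of_pos _ _ hR0, ENNReal.toReal_mul,
      ENNReal.toReal_ofReal (by positivity), finrank_euclideanSpace_fin, measureReal_def]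
  calc v * (m / 4) ^ ((3 : ℝ) / 2) * R ^ ((3 : ℝ) / 2)
      = ∫ x in Metric.ball (0 : R3) R, (m / (4 * R)) ^ ((3 : ℝ) / 2) := by
        rw [setIntegral_const, hball, smul_eq_mul, ← div_div,
          Real.div_rpow (by positivity) hR0.le]
        have h3 : R ^ 3 = R ^ ((3 : ℝ) / 2) * R ^ ((3 : ℝ) / 2) := by
          rw [← Real.rpow_add hR0, ← Real.rpow_natCast]
          norm_num
        rw [h3]
        field_simp
    _ ≤ ∫ x in Metric.ball (0 : R3) R, (max (-(m / (4 * R)) - ψ x) 0) ^ ((3 : ℝ) / 2) := by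
        refine setIntegral_mono_on (integrableOn_const measure_ball_lt_top.ne)
          (integrable_max_sub_rpow hc h0 he (by norm_num)).integrableOn measurableSet_ball
          fun x hx => ?_
        refine Real.rpow_le_rpow (by positivity) (le_max_of_le_left ?_) (by norm_num)
        rw [mem_ball_zero_iff] at hx
        have h1 : m / (2 * R) ≤ m / (1 + ‖x‖) := by
          gcongr
          linarith
        have h2 : m / (2 * R) = m / (4 * R) + m / (4 * R) := by
          field_simp
          norm_num
        linarith [hψ x]
    _ ≤ _ := setIntegral_le_integral (integrable_max_sub_rpow hc h0 he (by norm_num))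
        (Eventually.of_forall fun x => Real.rpow_nonneg (le_max_right _ _) _)

lemma aInv_neg_and_aphi_aInv {ψ : R3 → ℝ} (hc : Continuous ψ)
    (h0 : Tendsto ψ (cocompact R3) (nhds 0)) {m : ℝ} (hm : 0 < m)
    (hψ : ∀ x, m / (1 + ‖x‖) ≤ -ψ x) {s : ℝ} (hs : 0 < s) :
    aInv ψ s < 0 ∧ aphi ψ (aInv ψ s) = s := by
  obtain ⟨e₁, he₁, hse₁⟩ := exists_le_aphi hc h0 hm hψ s
  have hneg : aInv ψ s < 0 := (aInv_le hc h0 hs hse₁).trans_lt he₁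
  have hcont := continuousAt_aphi hc h0 hneg
  refine ⟨hneg, le_antisymm ?_ ?_⟩
  · refine le_of_tendsto (hcont.tendsto.mono_left (nhdsWithin_le_nhds (s := Iio (aInv ψ s)))) ?_
    filter_upwards [self_mem_nhdsWithin] with e he
    by_contra! hlt
    exact (aInv_le hc h0 hs hlt.le).not_gt he
  · by_contra! hlt
    obtain ⟨δ, hδ, hball⟩ := Metric.eventually_nhds_iff.1 (hcont.eventually (gt_mem_nhds hlt))
    obtain ⟨e, he, hle⟩ := exists_lt_of_csInf_lt (s := {e : ℝ | s ≤ aphi ψ e}) ⟨e₁, hse₁⟩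
      (lt_add_of_pos_right (aInv ψ s) hδ)
    have hge := aInv_le hc h0 hs he
    have := hball (y := e) (by rw [Real.dist_eq, abs_lt]; constructor <;> linarith)
    exact (not_lt.2 he) this

lemma integral_max_sub_rpow_half_pos {ψ : R3 → ℝ} (hc : Continuous ψ)
    (h0 : Tendsto ψ (cocompact R3) (nhds 0)) {e : ℝ} (he : e < 0) (hpos : 0 < aphi ψ e) :
    0 < ∫ x, (max (e - ψ x) 0) ^ ((1 : ℝ) / 2) := by
  obtain ⟨x, hx⟩ : ∃ x, ψ x < e := by
    by_contra! hall
    exact hpos.ne' (aphi_eq_zero_of_forall_le hall)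
  refine (continuous_max_sub_rpow hc (by norm_num)).integral_pos_of_hasCompactSupport_nonneg_nonzero
    (hasCompactSupport_max_sub_rpow h0 he (by norm_num))
    (fun y => Real.rpow_nonneg (le_max_right _ _) _) (x := x) ?_
  exact (Real.rpow_pos_of_pos (lt_max_of_lt_left (by linarith)) _).ne'

lemma memX.div_le_neg {φ : R3 → ℝ} (hφ : memX φ) (x : R3) : mX φ / (1 + ‖x‖) ≤ -φ x := by
  have h1 : mX φ ≤ (1 + ‖x‖) * |φ x| :=
    ciInf_le ⟨0, by rintro _ ⟨y, rfl⟩; positivity⟩ x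
  rw [abs_of_nonpos (hφ.2.1 x)] at h1
  rw [div_le_iff₀ (by positivity)]
  linarith

/-- A function lying on the appropriate side of every line of slope `c ≠ d` through
`(x, f x)` has derivative `d` at `x`. -/
lemma hasDerivAt_of_eventually_slope_le {f : ℝ → ℝ} {d x : ℝ}
    (hu : ∀ c, d < c → ∀ᶠ y in nhdsWithin x {x}ᶜ, slope f x y ≤ c)
    (hl : ∀ c, c < d → ∀ᶠ y in nhdsWithin x {x}ᶜ, c ≤ slope f x y) : HasDerivAt f d x := by
  rw [hasDerivAt_iff_tendsto_slope, tendsto_order]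
  constructor
  · intro a ha
    obtain ⟨c, hac, hcd⟩ := exists_between ha
    exact (hl c hcd).mono fun y hy => hac.trans_le hy
  · intro a ha
    obtain ⟨c, hdc, hca⟩ := exists_between ha
    exact (hu c hdc).mono fun y hy => hy.trans_lt hca

theorem jacobian_inverse_lambda_derivative (φ φ' : R3 → ℝ)
    (hφ : memX φ) (hφ' : memX φ') (h : R3 → ℝ) (hh : h = φ' - φ)
    (s : ℝ) (hs : 0 < s) :
    ∀ lam ∈ Icc (0 : ℝ) 1,
      HasDerivAt (fun l : ℝ => aInv (fun x => φ x + l * h x) s)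
        ((∫ x : R3,
            (max (aInv (fun x => φ x + lam * h x) s - φ x - lam * h x) 0) ^ ((1 : ℝ) / 2)
              * h x) /
          (∫ x : R3,
            (max (aInv (fun x => φ x + lam * h x) s - φ x - lam * h x) 0) ^ ((1 : ℝ) / 2)))
        lam := by
  intro lam hlam
  have hhx : ∀ x, h x = φ' x - φ x := fun x => by rw [hh]; rfl
  have hhc : Continuous h := hh ▸ hφ'.1.sub hφ.1
  have hh0 : Tendsto h (cocompact R3) (nhds 0) := by
    have := hφ'.2.2.1.sub hφ.2.2.1
    rw [sub_zero] at this
    exact hh ▸ this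
  have hc : ∀ l, Continuous (fun x => φ x + l * h x) := fun l => hφ.1.add (hhc.const_smul l)
  have h0 := tendsto_add_mul_cocompact hφ.2.2.1 hh0
  have hlow : ∀ x, min (mX φ) (mX φ') / (1 + ‖x‖) ≤ -(φ x + lam * h x) := fun x => by
    have h1 : min (mX φ) (mX φ') / (1 + ‖x‖) ≤ -φ x :=
      le_trans (by gcongr; exact min_le_left _ _) (hφ.div_le_neg x)
    have h2 : min (mX φ) (mX φ') / (1 + ‖x‖) ≤ -φ' x :=
      le_trans (by gcongr; exact min_le_right _ _) (hφ'.div_le_neg x)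
    rw [hhx]
    nlinarith [mul_le_mul_of_nonneg_left h1 (sub_nonneg.2 hlam.2),
      mul_le_mul_of_nonneg_left h2 hlam.1]
  obtain ⟨hneg, hval⟩ := aInv_neg_and_aphi_aInv (hc lam) (h0 lam)
    (lt_min hφ.2.2.2.2 hφ'.2.2.2.2) hlow hs
  simp only [sub_sub]
  set e := aInv (fun x => φ x + lam * h x) s with he
  set B := ∫ x : R3, (max (e - (φ x + lam * h x)) 0) ^ ((1 : ℝ) / 2) with hB
  set A := ∫ x : R3, (max (e - (φ x + lam * h x)) 0) ^ ((1 : ℝ) / 2) * h x with hA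
  have hBpos : 0 < B := integral_max_sub_rpow_half_pos (hc lam) (h0 lam) hneg (hval ▸ hs)
  have hintB : Integrable fun x : R3 => (max (e - (φ x + lam * h x)) 0) ^ ((1 : ℝ) / 2) :=
    integrable_max_sub_rpow (hc lam) (h0 lam) hneg (by norm_num)
  have hintA : Integrable fun x : R3 =>
      (max (e - (φ x + lam * h x)) 0) ^ ((1 : ℝ) / 2) * h x :=
    ((continuous_max_sub_rpow (hc lam) (by norm_num)).mul hhc).integrable_of_hasCompactSupport
      (hasCompactSupport_max_sub_rpow (h0 lam) hneg (by norm_num)).mul_right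
  have hder : ∀ c, Tendsto
      (slope (fun l => aphi (fun x => φ x + l * h x) (e + c * (l - lam))) lam)
      (nhdsWithin lam {lam}ᶜ)
      (nhds ((8 * π * Real.sqrt 2 / 3) * (3 / 2) * (c * B - A))) := by
    intro c
    have := hasDerivAt_aphi_affine hφ.1 hhc hφ.2.2.1 hh0 lam c hneg
    rw [hasDerivAt_iff_tendsto_slope] at this
    convert this using 2
    rw [mul_assoc, hB, hA, ← integral_const_mul, ← integral_sub (hintB.const_mul c) hintA,
      ← integral_const_mul]
    congr 2
    ext x
    ring
  have hval' : ∀ c, aphi (fun x => φ x + lam * h x) (e + c * (lam - lam)) = s := fun c => by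
    rw [sub_self, mul_zero, add_zero, hval]
  have hC : 0 < (8 * π * Real.sqrt 2 / 3) * (3 / 2) := mul_pos aphi_const_pos (by norm_num)
  have hnear : ∀ c, ∀ᶠ l in nhdsWithin lam {lam}ᶜ, e + c * (l - lam) < 0 := by
    intro c
    refine nhdsWithin_le_nhds ?_
    have : ContinuousAt (fun l => e + c * (l - lam)) lam := by fun_prop
    exact this.eventually (gt_mem_nhds (by simpa using hneg))
  have hup : ∀ l c, s < aphi (fun x => φ x + l * h x) (e + c * (l - lam)) →
      aInv (fun x => φ x + l * h x) s ≤ e + c * (l - lam) := fun l c hl =>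
    aInv_le (hc l) (h0 l) hs hl.le
  have hdn : ∀ l c, e + c * (l - lam) < 0 →
      aphi (fun x => φ x + l * h x) (e + c * (l - lam)) < s →
      e + c * (l - lam) ≤ aInv (fun x => φ x + l * h x) s := fun l c hl0 hl =>
    le_aInv (hc l) (h0 l) hl0 hl
  refine hasDerivAt_of_eventually_slope_le (fun c hcd => ?_) (fun c hcd => ?_)
  · have hpos : 0 < (8 * π * Real.sqrt 2 / 3) * (3 / 2) * (c * B - A) :=
      mul_pos hC (sub_pos.2 ((div_lt_iff₀ hBpos).1 hcd))
    filter_upwards [(hder c).eventually (lt_mem_nhds hpos), hnear c, self_mem_nhdsWithin]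
      with l hl hl0 hne
    rw [slope_def_field, hval'] at hl
    rw [slope_def_field]
    rcases lt_or_gt_of_ne (show l ≠ lam from hne) with hlt | hgt
    · have h1 : l - lam < 0 := by linarith
      have := hdn l c hl0 (by
        by_contra! hcon
        exact hl.not_ge (div_nonpos_of_nonneg_of_nonpos (by linarith) h1.le))
      rw [div_le_iff_of_neg h1]
      linarith
    · have h1 : 0 < l - lam := by linarith
      have := hup l c (by
        by_contra! hcon
        exact hl.not_ge (div_nonpos_of_nonpos_of_nonneg (by linarith) h1.le))
      rw [div_le_iff₀ h1]
      linarith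
  · have hlt0 : (8 * π * Real.sqrt 2 / 3) * (3 / 2) * (c * B - A) < 0 :=
      mul_neg_of_pos_of_neg hC (sub_neg.2 ((lt_div_iff₀ hBpos).1 hcd))
    filter_upwards [(hder c).eventually (gt_mem_nhds hlt0), hnear c, self_mem_nhdsWithin]
      with l hl hl0 hne
    rw [slope_def_field, hval'] at hl
    rw [slope_def_field]
    rcases lt_or_gt_of_ne (show l ≠ lam from hne) with hlt | hgt
    · have h1 : l - lam < 0 := by linarith
      have := hup l c (by
        by_contra! hcon
        exact hl.not_ge (div_nonneg_of_nonpos (by linarith) h1.le))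
      rw [le_div_iff_of_neg h1]
      linarith
    · have h1 : 0 < l - lam := by linarith
      have := hdn l c hl0 (by
        by_contra! hcon
        exact hl.not_ge (div_nonneg (by linarith) h1.le))
      rw [le_div_iff₀ h1]
      linarith
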